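/- For every real x > 0 and every q ∈ (1, q_x] that does not lie in the topological closure of 𝒰, the one-sided limits lim_{δ→0⁺} dim_H(𝒰(x) ∩ (q−δ, q+δ)) and lim_{δ→0⁺} dim_H(𝒰_q ∩ (x−δ, x+δ)) both exist and are equal (Hausdorff dimension with respect to the Euclidean metric on ℝ). -/

import Mathlib

open scoped ENNReal NNReal Classical

namespace Expansions

/-- Digit sequences over the alphabet `{0,1,…,M}`; index `i : ℕ` represents the
`(i+1)`-st digit `d_{i+1}` of the paper. -/
abbrev Digits (M : ℕ) := ℕ → Fin (M + 1)

/-- `π_q((d_i)) = Σ_{i≥1} d_i / q^i`. -/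
noncomputable def piQ (M : ℕ) (q : ℝ) (d : Digits M) : ℝ :=
  ∑' i : ℕ, (d i : ℝ) / q ^ (i + 1)

/-- `𝒰_q` : the set of real numbers having a unique `q`-expansion. -/
def Uq (M : ℕ) (q : ℝ) : Set ℝ := {x | ∃! d : Digits M, piQ M q d = x}

/-- `𝐔_q` : the set of sequences that are the unique `q`-expansion of their value. -/
def UqSym (M : ℕ) (q : ℝ) : Set (Digits M) :=
  {d | ∀ e : Digits M, piQ M q e = piQ M q d → e = d}

/-- `𝒰(x)` : the set of univoque bases of `x`. -/
def Ubases (M : ℕ) (x : ℝ) : Set ℝ :=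
  {q | q ∈ Set.Ioc (1 : ℝ) ((M : ℝ) + 1) ∧ x ∈ Uq M q}

/-- `q_x = min{M+1, 1+M/x}`. -/
noncomputable def qx (M : ℕ) (x : ℝ) : ℝ := min ((M : ℝ) + 1) (1 + (M : ℝ) / x)

/-- Strict lexicographic order on digit sequences. -/
def lexLt {M : ℕ} (c d : Digits M) : Prop := ∃ n, (∀ i < n, c i = d i) ∧ c n < d n

def lexLe {M : ℕ} (c d : Digits M) : Prop := c = d ∨ lexLt c d

/-- The sequence ends with `0^∞`. -/
def EndsInZero {M : ℕ} (d : Digits M) : Prop := ∃ N, ∀ n ≥ N, d n = 0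

/-- `d` is the quasi-greedy `q`-expansion of `x`: the lexicographically largest
`q`-expansion of `x` not ending with `0^∞`. -/
def IsQuasiGreedy (M : ℕ) (q x : ℝ) (d : Digits M) : Prop :=
  piQ M q d = x ∧ ¬ EndsInZero d ∧
    ∀ e : Digits M, piQ M q e = x → ¬ EndsInZero e → lexLe e d

/-- `Φ_x(q)`: the quasi-greedy `q`-expansion of `x` (junk value if none exists). -/
noncomputable def Phi (M : ℕ) (x q : ℝ) : Digits M :=
  if h : ∃ d : Digits M, IsQuasiGreedy M q x d then h.choose else fun _ => 0

/-- `𝐔(x) = {Φ_x(q) : q ∈ 𝒰(x)}`. -/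
def UxSym (M : ℕ) (x : ℝ) : Set (Digits M) := (Phi M x) '' (Ubases M x)

/-- `ρ((c_i),(d_i)) = (M+1)^{-inf{i ≥ 1 : c_i ≠ d_i}}` (our index `n` represents the
`(n+1)`-st digit, whence the exponent `-(n+1)`); `ρ(c,c) = 0`. -/
noncomputable def rho (M : ℕ) (c d : Digits M) : ℝ :=
  if c = d then 0
  else ((M : ℝ) + 1) ^ (-(((sInf {i | c i ≠ d i} : ℕ) : ℤ) + 1))

/-- Diameter of a set with respect to a distance function, valued in `ℝ≥0∞`. -/
noncomputable def gdiam {X : Type*} (dist : X → X → ℝ) (A : Set X) : ℝ≥0∞ :=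
  ⨆ x ∈ A, ⨆ y ∈ A, ENNReal.ofReal (dist x y)

/-- The `s`-dimensional Hausdorff outer measure with respect to a distance function:
`lim_{δ→0⁺} inf {Σ diam(C n)^s : A ⊆ ⋃ C n, diam (C n) ≤ δ}`. -/
noncomputable def gHMeasure {X : Type*} (dist : X → X → ℝ) (s : ℝ) (A : Set X) : ℝ≥0∞ :=
  ⨆ (δ : ℝ) (_ : 0 < δ),
    ⨅ (C : ℕ → Set X) (_ : A ⊆ ⋃ n, C n)
      (_ : ∀ n, gdiam dist (C n) ≤ ENNReal.ofReal δ),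
      ∑' n, gdiam dist (C n) ^ s

/-- Hausdorff dimension with respect to a distance function. -/
noncomputable def gdimH {X : Type*} (dist : X → X → ℝ) (A : Set X) : ℝ≥0∞ :=
  ⨆ (s : ℝ≥0) (_ : gHMeasure dist (s : ℝ) A = ⊤), (s : ℝ≥0∞)

/-- The generalized golden ratio `q_G`. -/
noncomputable def qG (M : ℕ) : ℝ :=
  if M % 2 = 0 then ((M / 2 : ℕ) : ℝ) + 1
  else (((M / 2 : ℕ) : ℝ) + 1 +
    Real.sqrt (((M / 2 : ℕ) : ℝ) ^ 2 + 6 * ((M / 2 : ℕ) : ℝ) + 5)) / 2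

/-- `x_G = M/(q_G - 1)`. -/
noncomputable def xG (M : ℕ) : ℝ := (M : ℝ) / (qG M - 1)

/-- The Komornik–Loreti constant `q_KL = min 𝒰(1)`. -/
noncomputable def qKL (M : ℕ) : ℝ := sInf (Ubases M 1)

/-- `x_KL = M/(q_KL - 1)`. -/
noncomputable def xKL (M : ℕ) : ℝ := (M : ℝ) / (qKL M - 1)

/-- `X_iso`: the set of `x > 0` such that `𝒰(x)` contains an isolated point. -/
def Xiso (M : ℕ) : Set ℝ :=
  {x | 0 < x ∧ ∃ q ∈ Ubases M x, ∃ ε > 0, Ubases M x ∩ Set.Ioo (q - ε) (q + ε) = {q}}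

/-- The bifurcation set `𝒱 = {q ∈ (1,M+1] : 𝐔_r ≠ 𝐔_q for all r > q}`. -/
def Vset (M : ℕ) : Set ℝ :=
  {q | q ∈ Set.Ioc (1 : ℝ) ((M : ℝ) + 1) ∧
    ∀ r ∈ Set.Ioc (1 : ℝ) ((M : ℝ) + 1), q < r → UqSym M r ≠ UqSym M q}

/-- The Thue–Morse sequence `τ_i` = parity of the binary digit sum of `i`. -/
def tm (i : ℕ) : ℕ := (Nat.digits 2 i).sum % 2

/-- The sequence `d` with its first `n` digits removed. -/
def shift {M : ℕ} (n : ℕ) (d : Digits M) : Digits M := fun i => d (i + n)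

/-- The sequence `d` if `b = false`, its reflection `(M - d_i)` if `b = true`. -/
def signed {M : ℕ} (b : Bool) (d : Digits M) : Digits M :=
  fun i => if b then Fin.rev (d i) else d i

section Basic

variable {M : ℕ}

theorem shift_zero (d : Digits M) : shift 0 d = d := rfl

theorem shift_shift (m n : ℕ) (d : Digits M) : shift m (shift n d) = shift (m + n) d := by
  funext i; simp [shift, add_assoc]

theorem shift_signed (b : Bool) (n : ℕ) (d : Digits M) :
    shift n (signed b d) = signed b (shift n d) := rfl

theorem signed_false (d : Digits M) : signed false d = d := by
  funext i; simp [signed]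

theorem signed_signed (a b : Bool) (d : Digits M) :
    signed a (signed b d) = signed (a ^^ b) d := by
  funext i; cases a <;> cases b <;> simp [signed]

theorem digit_le (d : Digits M) (i : ℕ) : (d i : ℝ) ≤ M := by
  exact_mod_cast Nat.lt_succ_iff.mp (d i).isLt

theorem hasSum_inv_pow {q : ℝ} (hq : 1 < q) :
    HasSum (fun i : ℕ => (M : ℝ) / q ^ (i + 1)) (M / (q - 1)) := by
  have h := (hasSum_geometric_of_lt_one (r := q⁻¹) (by positivity)
    (inv_lt_one_of_one_lt₀ hq)).mul_left ((M : ℝ) / q)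
  have hq0 : q ≠ 0 := by positivity
  have hq1 : q - 1 ≠ 0 := by linarith
  have h1 : (fun i : ℕ => (M : ℝ) / q * q⁻¹ ^ i) = fun i => (M : ℝ) / q ^ (i + 1) := by
    funext i
    rw [pow_succ, inv_pow]
    field_simp
  have h2 : (M : ℝ) / q * (1 - q⁻¹)⁻¹ = M / (q - 1) := by
    rw [show (1 - q⁻¹ : ℝ) = (q - 1) / q by field_simp]
    field_simp
  rwa [h1, h2] at h

theorem summable_piQ {q : ℝ} (hq : 1 < q) (d : Digits M) :
    Summable (fun i : ℕ => (d i : ℝ) / q ^ (i + 1)) := by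
  refine Summable.of_nonneg_of_le (fun i => by positivity) (fun i => ?_)
    (hasSum_inv_pow (M := M) hq).summable
  exact div_le_div_of_nonneg_right (digit_le d i) (by positivity)

theorem piQ_nonneg {q : ℝ} (hq : 1 < q) (d : Digits M) : 0 ≤ piQ M q d :=
  tsum_nonneg fun i => by positivity

theorem piQ_shift_one {q : ℝ} (hq : 1 < q) (d : Digits M) :
    q * piQ M q d = d 0 + piQ M q (shift 1 d) := by
  have hq0 : q ≠ 0 := by positivity
  unfold piQ
  rw [(summable_piQ hq d).tsum_eq_zero_add, mul_add, ← tsum_mul_left]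
  congr 1
  · rw [zero_add, pow_one, mul_div_cancel₀ _ hq0]
  · refine tsum_congr fun i => ?_
    simp only [shift]
    rw [pow_succ q (i + 1)]
    field_simp

theorem piQ_add_signed_true {q : ℝ} (hq : 1 < q) (d : Digits M) :
    piQ M q d + piQ M q (signed true d) = M / (q - 1) := by
  unfold piQ
  rw [← (summable_piQ hq d).tsum_add (summable_piQ hq (signed true d)),
    ← (hasSum_inv_pow (M := M) hq).tsum_eq]
  refine tsum_congr fun i => ?_
  have h : (d i : ℕ) ≤ M := Nat.lt_succ_iff.mp (d i).isLt
  simp only [signed, if_true, Fin.val_rev]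
  rw [← add_div, Nat.add_sub_add_right, Nat.cast_sub h]
  ring

theorem piQ_le {q : ℝ} (hq : 1 < q) (d : Digits M) : piQ M q d ≤ M / (q - 1) := by
  have := piQ_nonneg hq (signed true d)
  linarith [piQ_add_signed_true hq d]

theorem piQ_sub_of_agree {q : ℝ} (hq : 1 < q) (n : ℕ) {c d : Digits M}
    (h : ∀ i < n, c i = d i) :
    q ^ n * (piQ M q d - piQ M q c) = piQ M q (shift n d) - piQ M q (shift n c) := by
  induction n with
  | zero => simp [shift_zero]
  | succ n ih =>
    have h1 := ih fun i hi => h i (by omega)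
    have hc := piQ_shift_one hq (shift n c)
    have hd := piQ_shift_one hq (shift n d)
    rw [shift_shift, add_comm 1 n] at hc hd
    have h0 : (shift n c) 0 = (shift n d) 0 := by simpa [shift] using h n (by omega)
    rw [h0] at hc
    rw [pow_succ]
    linear_combination q * h1 + hd - hc

theorem piQ_sub_of_agree_succ {q : ℝ} (hq : 1 < q) (n : ℕ) {c d : Digits M}
    (h : ∀ i < n, c i = d i) :
    q ^ (n + 1) * (piQ M q d - piQ M q c) =
      ((d n : ℝ) - c n) + (piQ M q (shift (n + 1) d) - piQ M q (shift (n + 1) c)) := by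
  have h1 := piQ_sub_of_agree hq n h
  have hc := piQ_shift_one hq (shift n c)
  have hd := piQ_shift_one hq (shift n d)
  rw [shift_shift, add_comm 1 n] at hc hd
  simp only [shift, zero_add] at hc hd h1 ⊢
  rw [pow_succ]
  linear_combination q * h1 + hd - hc

theorem piQ_scale {p q : ℝ} (hp : 1 < p) (hpq : p ≤ q) (d : Digits M) :
    q * piQ M q d ≤ p * piQ M p d := by
  have hq : 1 < q := hp.trans_le hpq
  unfold piQ
  rw [← tsum_mul_left, ← tsum_mul_left]
  refine Summable.tsum_le_tsum (fun i => ?_) ((summable_piQ hq d).mul_left q)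
    ((summable_piQ hp d).mul_left p)
  have h1 : q * ((d i : ℝ) / q ^ (i + 1)) = d i / q ^ i := by
    rw [pow_succ]; field_simp
  have h2 : p * ((d i : ℝ) / p ^ (i + 1)) = d i / p ^ i := by
    rw [pow_succ]; field_simp
  rw [h1, h2]
  gcongr

theorem piQ_anti {p q : ℝ} (hp : 1 < p) (hpq : p ≤ q) (d : Digits M) :
    piQ M q d ≤ piQ M p d := by
  have h := piQ_scale hp hpq d
  have h0 := piQ_nonneg (hp.trans_le hpq) d
  nlinarith

theorem piQ_sub_le {p q : ℝ} (hp : 1 < p) (hpq : p ≤ q) (d : Digits M) :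
    piQ M p d - piQ M q d ≤ M / ((p - 1) * (q - 1)) * (q - p) := by
  have hq : 1 < q := hp.trans_le hpq
  have h := piQ_anti hp hpq (signed true d)
  have h1 := piQ_add_signed_true hp d
  have h2 := piQ_add_signed_true hq d
  have h3 : (M : ℝ) / (p - 1) - M / (q - 1) = M / ((p - 1) * (q - 1)) * (q - p) := by
    have : p - 1 ≠ 0 := by linarith
    have : q - 1 ≠ 0 := by linarith
    field_simp
    ring
  linarith

theorem abs_piQ_sub_le {r p q : ℝ} (hr : 1 < r) (hp : r ≤ p) (hq : r ≤ q) (d : Digits M) :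
    |piQ M p d - piQ M q d| ≤ M / (r - 1) ^ 2 * |p - q| := by
  wlog hpq : p ≤ q generalizing p q
  · rw [abs_sub_comm, abs_sub_comm p q]
    exact this hq hp (le_of_not_ge hpq)
  have h1 := piQ_anti (hr.trans_le hp) hpq d
  rw [abs_of_nonneg (by linarith), abs_sub_comm, abs_of_nonneg (by linarith : 0 ≤ q - p)]
  refine (piQ_sub_le (hr.trans_le hp) hpq d).trans ?_
  have : 0 < r - 1 := by linarith
  have : 0 ≤ q - p := by linarith
  have h2 : (r - 1) ^ 2 ≤ (p - 1) * (q - 1) := by nlinarith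
  gcongr

theorem continuousOn_piQ (d : Digits M) : ContinuousOn (fun p => piQ M p d) (Set.Ioi 1) := by
  intro p hp
  have hp' : (1 : ℝ) < p := hp
  set r := (1 + p) / 2 with hr
  have hr1 : 1 < r := by linarith
  have hrp : r < p := by linarith
  have : LipschitzOnWith (Real.toNNReal (M / (r - 1) ^ 2)) (fun p => piQ M p d) (Set.Ioi r) := by
    refine LipschitzOnWith.of_dist_le_mul fun a ha b hb => ?_
    rw [Real.dist_eq, Real.dist_eq, Real.coe_toNNReal _ (by positivity)]
    exact abs_piQ_sub_le hr1 (le_of_lt ha) (le_of_lt hb) d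
  exact ((this.continuousOn).continuousAt (Ioi_mem_nhds hrp)).continuousWithinAt

theorem exists_piQ_eq_of_le {a b y : ℝ} (ha : 1 < a) (hab : a ≤ b) (d : Digits M)
    (h1 : y ≤ piQ M a d) (h2 : piQ M b d ≤ y) : ∃ p ∈ Set.Icc a b, piQ M p d = y := by
  have := intermediate_value_Icc' hab ((continuousOn_piQ d).mono fun p hp =>
    lt_of_lt_of_le ha hp.1)
  obtain ⟨p, hp, h⟩ := this ⟨h2, h1⟩
  exact ⟨p, hp, h⟩

end Basic

section Univoque

variable {M : ℕ}

theorem exists_piQ_eq {q : ℝ} (hq : 1 < q) (hqM : q ≤ M + 1) {y : ℝ} (hy0 : 0 ≤ y)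
    (hy : y ≤ M / (q - 1)) : ∃ d : Digits M, piQ M q d = y := by
  have hq1 : 0 < q - 1 := by linarith
  have hone : 1 ≤ (M : ℝ) / (q - 1) := by rw [le_div_iff₀ hq1]; linarith
  let dig : ℝ → Fin (M + 1) := fun z => ⟨min M ⌊q * z⌋₊, by omega⟩
  let s : ℕ → ℝ := fun k => Nat.rec y (fun _ z => q * z - dig z) k
  have hs : ∀ k, s (k + 1) = q * s k - dig (s k) := fun k => rfl
  have hbd : ∀ k, 0 ≤ s k ∧ s k ≤ M / (q - 1) := by
    intro k
    induction k with
    | zero => exact ⟨hy0, hy⟩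
    | succ k ih =>
      rw [hs]
      have h0 : 0 ≤ q * s k := by have := ih.1; positivity
      have h1 : q * s k ≤ M + M / (q - 1) := by
        have : q * (M / (q - 1)) = M + M / (q - 1) := by field_simp; ring
        rw [← this]
        exact mul_le_mul_of_nonneg_left ih.2 (by linarith)
      have h2 := Nat.floor_le h0
      have h3 := Nat.lt_floor_add_one (q * s k)
      simp only [dig]
      rcases le_total M ⌊q * s k⌋₊ with h | h
      · rw [min_eq_left h]
        have : (M : ℝ) ≤ ⌊q * s k⌋₊ := by exact_mod_cast h
        constructor <;> linarith
      · rw [min_eq_right h]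
        constructor <;> linarith
  refine ⟨fun k => dig (s k), ?_⟩
  set d : Digits M := fun k => dig (s k) with hd
  have herr : ∀ k, q ^ k * (y - piQ M q d) = s k - piQ M q (shift k d) := by
    intro k
    induction k with
    | zero => simp [shift_zero, s]
    | succ k ih =>
      have h := piQ_shift_one hq (shift k d)
      rw [shift_shift, add_comm 1 k] at h
      have h0 : (shift k d) 0 = dig (s k) := by simp [shift, hd]
      rw [h0] at h
      rw [hs, pow_succ]
      linear_combination q * ih - h
  by_contra hne
  have hpos : 0 < |y - piQ M q d| := abs_pos.mpr fun h => hne (by linarith)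
  obtain ⟨k, hk⟩ := pow_unbounded_of_one_lt (M / (q - 1) / |y - piQ M q d|) hq
  rw [div_lt_iff₀ hpos] at hk
  have h1 : |q ^ k * (y - piQ M q d)| ≤ M / (q - 1) := by
    rw [herr, abs_le]
    have := hbd k
    have := piQ_nonneg hq (shift k d)
    have := piQ_le hq (shift k d)
    constructor <;> linarith
  rw [abs_mul, abs_of_pos (by positivity : 0 < q ^ k)] at h1
  linarith

theorem exists_first_ne {c d : Digits M} (h : c ≠ d) :
    ∃ n, (∀ i < n, c i = d i) ∧ c n ≠ d n := by
  have h' : ∃ n, c n ≠ d n := Function.ne_iff.mp h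
  exact ⟨Nat.find h', fun i hi => not_not.mp (Nat.find_min h' hi), Nat.find_spec h'⟩

theorem signed_mem_UqSym {q : ℝ} (hq : 1 < q) (b : Bool) {d : Digits M} (hd : d ∈ UqSym M q) :
    signed b d ∈ UqSym M q := by
  cases b
  · rwa [signed_false]
  · intro e he
    have h1 := piQ_add_signed_true hq d
    have h2 := piQ_add_signed_true hq e
    have h3 := hd (signed true e) (by linarith)
    rw [← h3, signed_signed]
    exact (signed_false e).symm

theorem piQ_shift_lt_one {q : ℝ} (hq : 1 < q) (hqM : q ≤ M + 1) {d : Digits M}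
    (hd : d ∈ UqSym M q) {n : ℕ} (hn : (d n : ℕ) < M) : piQ M q (shift (n + 1) d) < 1 := by
  by_contra! hge
  obtain ⟨g, hg⟩ := exists_piQ_eq hq hqM (y := piQ M q (shift (n + 1) d) - 1) (by linarith)
    (by linarith [piQ_le hq (shift (n + 1) d)])
  let f : Digits M := fun i =>
    if i < n then d i else if i = n then ⟨d n + 1, by omega⟩ else g (i - (n + 1))
  have hf1 : ∀ i < n, d i = f i := fun i hi => by simp [f, hi]
  have hf2 : ((f n : ℕ) : ℝ) = d n + 1 := by simp [f]
  have hf3 : shift (n + 1) f = g := by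
    funext i
    simp only [shift, f]
    rw [if_neg (by omega), if_neg (by omega)]
    congr 1
    omega
  have h := piQ_sub_of_agree_succ hq n hf1
  rw [hf2, hf3, hg] at h
  have h0 : piQ M q f = piQ M q d := by
    have : q ^ (n + 1) * (piQ M q f - piQ M q d) = 0 := by rw [h]; ring
    rcases mul_eq_zero.mp this with h | h
    · exact absurd h (by positivity)
    · linarith
  have := hd f h0
  rw [this] at hf2
  linarith

theorem mem_UqSym_iff {q : ℝ} (hq : 1 < q) (hqM : q ≤ M + 1) {d : Digits M} :
    d ∈ UqSym M q ↔
      ∀ b n, (signed b d n : ℕ) < M → piQ M q (shift (n + 1) (signed b d)) < 1 := by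
  refine ⟨fun hd b n hn => piQ_shift_lt_one hq hqM (signed_mem_UqSym hq b hd) hn, fun h e he => ?_⟩
  by_contra hne
  obtain ⟨n, hn, hne⟩ := exists_first_ne hne
  have h1 := piQ_sub_of_agree_succ hq n hn
  rw [he, sub_self, mul_zero] at h1
  rcases lt_or_gt_of_ne hne with hlt | hlt
  · have h2 : (e n : ℕ) + 1 ≤ d n := hlt
    have hdM := (d n).isLt
    have h3 := h true n (by simp only [signed, if_true, Fin.val_rev]; omega)
    rw [shift_signed] at h3
    have h4 := piQ_add_signed_true hq (shift (n + 1) d)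
    have h5 := piQ_le hq (shift (n + 1) e)
    have h6 : (e n : ℝ) + 1 ≤ d n := by exact_mod_cast h2
    linarith
  · have h2 : (d n : ℕ) + 1 ≤ e n := hlt
    have h3 := h false n (by rw [signed_false]; omega)
    rw [signed_false] at h3
    have h5 := piQ_nonneg hq (shift (n + 1) e)
    have h6 : (d n : ℝ) + 1 ≤ e n := by exact_mod_cast h2
    linarith

theorem UqSym_mono {p q : ℝ} (hp : 1 < p) (hpq : p ≤ q) (hqM : q ≤ M + 1) :
    UqSym M p ⊆ UqSym M q := by
  intro d hd
  rw [mem_UqSym_iff (hp.trans_le hpq) hqM]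
  rw [mem_UqSym_iff hp (hpq.trans hqM)] at hd
  exact fun b n hn => (piQ_anti hp hpq _).trans_lt (hd b n hn)

theorem piQ_shift_succ_lt_one {q : ℝ} (hq : 1 < q) (hqM : q ≤ M + 1) {d : Digits M}
    (hd : d ∈ UqSym M q) {n : ℕ} (hn : piQ M q (shift n d) < 1) :
    piQ M q (shift (n + 1) d) < 1 := by
  rcases lt_or_ge (d n : ℕ) M with h | h
  · exact piQ_shift_lt_one hq hqM hd h
  · have h1 := piQ_shift_one hq (shift n d)
    rw [shift_shift, add_comm 1 n] at h1
    have h2 : ((shift n d 0 : ℕ) : ℝ) ≥ M := by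
      simp only [shift, zero_add]
      exact_mod_cast h
    nlinarith

theorem piQ_shift_lt_one_of_le {q : ℝ} (hq : 1 < q) (hqM : q ≤ M + 1) {d : Digits M}
    (hd : d ∈ UqSym M q) {m n : ℕ} (hmn : m ≤ n) (hm : piQ M q (shift m d) < 1) :
    piQ M q (shift n d) < 1 := by
  induction n, hmn using Nat.le_induction with
  | base => exact hm
  | succ n _ ih => exact piQ_shift_succ_lt_one hq hqM hd ih

theorem piQ_pos {q : ℝ} (hq : 1 < q) {d : Digits M} {i : ℕ} (hi : d i ≠ 0) : 0 < piQ M q d := by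
  refine (summable_piQ hq d).tsum_pos (fun j => by positivity) i ?_
  have : 0 < (d i : ℕ) := Nat.pos_of_ne_zero fun h => hi (Fin.ext h)
  positivity

/-- If every member of a shift-invariant family either has value at most `1 + γ` or is
lexicographically smaller than `e`, where `e` has value at most `1`, then every member has value
at most `1 + γ`. -/
theorem piQ_le_of_lexLt {r γ : ℝ} (hr : 1 < r) (hγ : 0 ≤ γ) {e : Digits M}
    (he : piQ M r e ≤ 1) {T : Set (Digits M)} (hT : ∀ v ∈ T, ∀ n, shift n v ∈ T)
    (h : ∀ v ∈ T, piQ M r v ≤ 1 + γ ∨ lexLt v e) : ∀ v ∈ T, piQ M r v ≤ 1 + γ := by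
  by_contra! hcon
  obtain ⟨v₀, hv₀, hlt⟩ := hcon
  have hbdd : BddAbove (piQ M r '' T) :=
    ⟨M / (r - 1), by rintro _ ⟨v, -, rfl⟩; exact piQ_le hr v⟩
  set S := sSup (piQ M r '' T) with hS
  have hle : ∀ v ∈ T, piQ M r v ≤ S := fun v hv => le_csSup hbdd ⟨v, hv, rfl⟩
  have hS1 : 1 + γ < S := hlt.trans_le (hle v₀ hv₀)
  have hkey : ∀ v ∈ T, piQ M r v ≤ max (1 + γ) (1 + (S - 1) / r) := by
    intro v hv
    rcases h v hv with h | ⟨k, hk, hlt⟩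
    · exact h.trans (le_max_left _ _)
    · refine le_trans ?_ (le_max_right _ _)
      have h1 := piQ_sub_of_agree_succ hr k hk
      have h2 := hle _ (hT v hv (k + 1))
      have h3 := piQ_nonneg hr (shift (k + 1) e)
      have h4 : (v k : ℝ) + 1 ≤ e k := by exact_mod_cast (show (v k : ℕ) + 1 ≤ e k from hlt)
      have h5 : r ^ (k + 1) * (piQ M r v - piQ M r e) ≤ S - 1 := by linarith
      have h6 : piQ M r v - piQ M r e ≤ (S - 1) / r := by
        rw [le_div_iff₀ (by positivity)]
        rcases le_or_gt (piQ M r v - piQ M r e) 0 with h | h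
        · have : 0 ≤ S - 1 := by linarith
          nlinarith
        · have h7 : r ≤ r ^ (k + 1) := le_self_pow₀ hr.le (by omega)
          nlinarith
      linarith
  have hSle : S ≤ max (1 + γ) (1 + (S - 1) / r) :=
    csSup_le ⟨_, v₀, hv₀, rfl⟩ (by rintro _ ⟨v, hv, rfl⟩; exact hkey v hv)
  rcases le_max_iff.mp hSle with h | h
  · linarith
  · have : (S - 1) / r < S - 1 := div_lt_self (by linarith) hr
    linarith

/-- The sequence `t` together with all its proper tails and their reflections. -/
def signedTails (t : Digits M) : Set (Digits M) :=
  {v | v = t ∨ ∃ b n, v = signed b (shift (n + 1) t)}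

theorem shift_mem_signedTails {t : Digits M} :
    ∀ v ∈ signedTails t, ∀ n, shift n v ∈ signedTails t := by
  rintro v (rfl | ⟨b, m, rfl⟩) n
  · rcases n with _ | n
    · exact Or.inl rfl
    · exact Or.inr ⟨false, n, (signed_false _).symm⟩
  · refine Or.inr ⟨b, n + m, ?_⟩
    rw [shift_signed, shift_shift, add_assoc]

/-- A base in which `1` has an expansion that is strictly larger than all its shifts and their
reflections is univoque. -/
theorem mem_Ubases_one {p : ℝ} (hp : 1 < p) (hpM : p ≤ M + 1) {e : Digits M}
    (he : piQ M p e = 1) (h : ∀ b n, lexLt (signed b (shift (n + 1) e)) e) :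
    p ∈ Ubases M 1 := by
  have hle : ∀ v ∈ signedTails e, piQ M p v ≤ 1 := by
    have := piQ_le_of_lexLt hp le_rfl he.le shift_mem_signedTails (by
      rintro v (rfl | ⟨b, m, rfl⟩)
      · exact Or.inl (by linarith)
      · exact Or.inr (h b m))
    simpa using this
  have hpos : ∀ n, 0 < piQ M p (shift (n + 1) e) := by
    intro n
    by_contra hcon
    have h0 : ∀ i, shift (n + 1) e i = 0 := fun i => by
      by_contra hi
      exact hcon (piQ_pos hp hi)
    obtain ⟨k, -, hk⟩ := h true n
    have : signed true (shift (n + 1) e) k = Fin.last M := by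
      simp [signed, h0 k]
    rw [this] at hk
    exact absurd hk (not_lt.mpr (Fin.le_last _))
  have hlt : ∀ b n, piQ M p (signed b (shift (n + 1) e)) < 1 := by
    intro b n
    obtain ⟨k, hk, hkk⟩ := h b n
    have h1 := piQ_sub_of_agree_succ hp k hk
    have h2 := hle _ (shift_mem_signedTails _ (Or.inr ⟨b, n, rfl⟩) (k + 1))
    have h3 := hpos k
    have h4 : ((signed b (shift (n + 1) e) k : ℕ) : ℝ) + 1 ≤ e k := by
      exact_mod_cast (show (signed b (shift (n + 1) e) k : ℕ) + 1 ≤ e k from hkk)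
    rw [he] at h1
    have h5 : 0 < p ^ (k + 1) := by positivity
    nlinarith
  refine ⟨⟨hp, hpM⟩, e, he, fun f hf => ?_⟩
  have hmem : e ∈ UqSym M p := by
    rw [mem_UqSym_iff hp hpM]
    intro b n _
    exact hlt b n
  exact hmem f (hf.trans he.symm)

end Univoque

section Dimension

variable {M : ℕ}

theorem dimH_eq_of_countable_diff {A K : Set ℝ} (hKA : K ⊆ A) (hc : (A \ K).Countable) :
    dimH A = dimH K := by
  rw [← Set.union_sdiff_cancel hKA, dimH_union, dimH_countable hc]
  simp

theorem dimH_le_of_rel {A B : Set ℝ} {R : ℝ → ℝ → Prop} {C t : ℝ} (hC : 0 ≤ C) (ht : 0 < t)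
    (hR : ∀ a ∈ A, ∃ b ∈ B, R a b)
    (hH : ∀ a a' b b', R a b → R a' b' → |a - a'| ≤ C * |b - b'| ^ t) :
    dimH A ≤ dimH B / ENNReal.ofReal t := by
  choose! φ hφB hφR using hR
  have hinj : Set.InjOn φ A := by
    intro a ha a' ha' h
    have := hH a a' _ _ (hφR a ha) (hφR a' ha')
    rw [h, sub_self, abs_zero, Real.zero_rpow ht.ne', mul_zero] at this
    exact sub_eq_zero.mp (abs_eq_zero.mp (le_antisymm this (abs_nonneg _)))
  have hleft := hinj.leftInvOn_invFunOn
  have hHol : HolderOnWith C.toNNReal t.toNNReal (Function.invFunOn φ A) (φ '' A) := by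
    rintro _ ⟨a, ha, rfl⟩ _ ⟨a', ha', rfl⟩
    rw [hleft ha, hleft ha', edist_dist, edist_dist, Real.dist_eq, Real.dist_eq,
      Real.coe_toNNReal _ ht.le, ENNReal.ofReal_rpow_of_nonneg (abs_nonneg _) ht.le,
      ← ENNReal.ofReal, ← ENNReal.ofReal_mul hC]
    exact ENNReal.ofReal_le_ofReal (hH _ _ _ _ (hφR a ha) (hφR a' ha'))
  have h1 := hHol.dimH_image_le (by simpa using ht)
  have h2 : Function.invFunOn φ A '' (φ '' A) = A := by
    rw [← Set.image_comp]
    exact (Set.image_congr fun a ha => hleft ha).trans (Set.image_id A)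
  rw [h2] at h1
  refine h1.trans (ENNReal.div_le_div_right (dimH_mono ?_) _)
  rintro _ ⟨a, ha, rfl⟩
  exact hφB a ha

theorem le_rpow_of_pow_bounds {u v a b κ C t : ℝ} {N : ℕ} (hκ : 0 < κ) (hu : 0 < u)
    (ha : 0 ≤ a) (hb : 0 ≤ b) (ht : 0 < t) (h1 : κ ≤ u ^ N * a) (h2 : v ^ N * b ≤ C)
    (huv : u ^ t ≤ v) : b ≤ C / κ ^ t * a ^ t := by
  have h3 : κ ^ t ≤ (u ^ t) ^ N * a ^ t := by
    rw [← Real.rpow_natCast (u ^ t), ← Real.rpow_mul hu.le, mul_comm t, Real.rpow_mul hu.le,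
      Real.rpow_natCast, ← Real.mul_rpow (by positivity) ha]
    exact Real.rpow_le_rpow hκ.le h1 ht.le
  have hut : 0 < u ^ t := Real.rpow_pos_of_pos hu t
  have h4 : (u ^ t) ^ N ≤ v ^ N := by gcongr
  have hat : 0 ≤ a ^ t := by positivity
  rw [div_mul_eq_mul_div, le_div_iff₀ (Real.rpow_pos_of_pos hκ t)]
  calc b * κ ^ t ≤ b * (v ^ N * a ^ t) := by
        gcongr
        exact h3.trans (by gcongr)
    _ = v ^ N * b * a ^ t := by ring
    _ ≤ C * a ^ t := by gcongr

theorem piQ_separation {p₀ r : ℝ} (hp₀ : 1 < p₀) (hr : p₀ < r) {c d : Digits M}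
    (hc : c ∈ UqSym M p₀) (hd : d ∈ UqSym M p₀) (hcd : c ≠ d) :
    ∃ N : ℕ, ∀ p, r ≤ p → p ≤ M + 1 →
      1 - p₀ / r ≤ p ^ N * |piQ M p c - piQ M p d| ∧
      p ^ N * |piQ M p c - piQ M p d| ≤ M + M / (r - 1) := by
  obtain ⟨n, hn, hne⟩ := exists_first_ne hcd
  wlog hlt : c n < d n generalizing c d
  · obtain ⟨N, hN⟩ := this hd hc hcd.symm (fun i hi => (hn i hi).symm) hne.symm
      (lt_of_le_of_ne (not_lt.mp hlt) hne.symm)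
    exact ⟨N, fun p h1 h2 => by rw [abs_sub_comm]; exact hN p h1 h2⟩
  refine ⟨n + 1, fun p hrp hpM => ?_⟩
  have hp : 1 < p := hp₀.trans (hr.trans_le hrp)
  have h1 := piQ_sub_of_agree_succ hp n hn
  have h2 : (c n : ℕ) + 1 ≤ d n := hlt
  have h3 : (c n : ℝ) + 1 ≤ d n := by exact_mod_cast h2
  have hdM := (d n).isLt
  have h4 := piQ_shift_lt_one hp₀ ((hr.trans_le hrp).le.trans hpM) hc (n := n) (by omega)
  have h5 := piQ_scale hp₀ (hr.trans_le hrp).le (shift (n + 1) c)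
  have h6 := piQ_nonneg hp (shift (n + 1) d)
  have h6' := piQ_nonneg hp (shift (n + 1) c)
  have h7 := piQ_le hp (shift (n + 1) d)
  have h8 : piQ M p (shift (n + 1) c) ≤ p₀ / r := by
    rw [le_div_iff₀ (by linarith)]
    nlinarith
  have h9 : p₀ / r < 1 := by rw [div_lt_one (by linarith)]; exact hr
  have hpos : 0 < p ^ (n + 1) := by positivity
  have h10 : 1 - p₀ / r ≤ p ^ (n + 1) * (piQ M p d - piQ M p c) := by linarith
  have h11 : 0 ≤ piQ M p d - piQ M p c := by
    by_contra hneg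
    nlinarith
  have h12 : (M : ℝ) / (p - 1) ≤ M / (r - 1) := by
    have : 0 < r - 1 := by linarith
    gcongr
  have h13 := digit_le d n
  have h14 : (0 : ℝ) ≤ c n := by positivity
  rw [abs_sub_comm, abs_of_nonneg h11]
  exact ⟨h10, by linarith⟩

theorem exists_nhds_rpow_le {q t : ℝ} (hq : 1 < q) (ht : t < 1) :
    ∃ δ > 0, ∀ p, |p - q| < δ → q ^ t ≤ p ∧ p ^ t ≤ q := by
  have hlt : q ^ t < q := by
    simpa using Real.rpow_lt_rpow_of_exponent_lt hq ht
  have h1 : ∀ᶠ p in nhds q, q ^ t < p := eventually_gt_nhds hlt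
  have h2 : ∀ᶠ p in nhds q, p ^ t < q :=
    (Real.continuousAt_rpow_const q t (Or.inl (by linarith))).eventually_lt_const hlt
  obtain ⟨δ, hδ, h⟩ := Metric.eventually_nhds_iff.mp (h1.and h2)
  exact ⟨δ, hδ, fun p hp => ⟨(h (by rwa [Real.dist_eq])).1.le, (h (by rwa [Real.dist_eq])).2.le⟩⟩

theorem piQ_base_inj {p₁ p₂ x : ℝ} (hx : 0 < x) (h₁ : 1 < p₁) (h₂ : 1 < p₂) {d : Digits M}
    (hd₁ : piQ M p₁ d = x) (hd₂ : piQ M p₂ d = x) : p₁ = p₂ := by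
  rcases le_total p₁ p₂ with h | h
  · have := piQ_scale h₁ h d
    nlinarith
  · have := piQ_scale h₂ h d
    nlinarith

theorem base_value_holder {p₀ q x t : ℝ} (hp₀ : 1 < p₀) (hpq : p₀ < q) (hqM : q < M + 1)
    (hx : 0 < x) (ht0 : 0 < t) (ht1 : t < 1) :
    ∃ C ≥ 0, ∃ δ > 0, p₀ < q - δ ∧ q + δ ≤ M + 1 ∧
      ∀ p₁ ∈ Set.Ioo (q - δ) (q + δ), ∀ p₂ ∈ Set.Ioo (q - δ) (q + δ),
      ∀ c ∈ UqSym M p₀, ∀ d ∈ UqSym M p₀, piQ M p₁ c = x → piQ M p₂ d = x →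
        |p₁ - p₂| ≤ C * |piQ M q c - piQ M q d| ^ t ∧
        |piQ M q c - piQ M q d| ≤ C * |p₁ - p₂| ^ t := by
  obtain ⟨δ₁, hδ₁, hpow⟩ := exists_nhds_rpow_le (hp₀.trans hpq) ht1
  set r := (p₀ + q) / 2 with hr
  have hr₀ : p₀ < r := by linarith
  have hr1 : 1 < r := by linarith
  set δ := min δ₁ (min (q - r) (M + 1 - q)) with hδ
  have hδpos : 0 < δ := lt_min hδ₁ (lt_min (by linarith) (by linarith))
  have hδa : δ ≤ δ₁ := min_le_left _ _
  have hδb : δ ≤ q - r := (min_le_right _ _).trans (min_le_left _ _)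
  have hδc : δ ≤ M + 1 - q := (min_le_right _ _).trans (min_le_right _ _)
  set κ := 1 - p₀ / r with hκ
  have hκpos : 0 < κ := by
    have : p₀ / r < 1 := by rw [div_lt_one (by linarith)]; exact hr₀
    linarith
  set E := (M : ℝ) + M / (r - 1) with hE
  have hr1' : 0 < r - 1 := by linarith
  have hEpos : 0 ≤ E := by positivity
  set B := (M : ℝ) / (r - 1) ^ 2 with hB
  have hBpos : 0 ≤ B := by positivity
  have hκt : 0 < κ ^ t := Real.rpow_pos_of_pos hκpos t
  set C₁ := ((M : ℝ) + 1) / x * (E / κ ^ t) with hC₁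
  set C₂ := E / κ ^ t * B ^ t with hC₂
  have hC₁0 : 0 ≤ C₁ := by positivity
  have hC₂0 : 0 ≤ C₂ := by positivity
  refine ⟨max C₁ C₂, hC₁0.trans (le_max_left _ _), δ, hδpos, by linarith, by linarith, ?_⟩
  intro p₁ hp₁ p₂ hp₂ c hc d hd hc1 hd1
  wlog hle : p₁ ≤ p₂ generalizing p₁ p₂ c d
  · rw [abs_sub_comm p₁, abs_sub_comm (piQ M q c)]
    exact this p₂ hp₂ p₁ hp₁ d hd c hc hd1 hc1 (le_of_not_ge hle)
  have h11 : 1 < p₁ := by linarith [hp₁.1]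
  have h21 : 1 < p₂ := by linarith [hp₂.1]
  have hrp₁ : r ≤ p₁ := by linarith [hp₁.1]
  have hrp₂ : r ≤ p₂ := by linarith [hp₂.1]
  rcases eq_or_ne c d with rfl | hcd
  · rw [piQ_base_inj hx h11 h21 hc1 hd1]
    simp [Real.zero_rpow ht0.ne']
  obtain ⟨N, hN⟩ := piQ_separation hp₀ hr₀ hc hd hcd
  obtain ⟨hq1, hq2⟩ := hN q (by linarith) hqM.le
  obtain ⟨ha1, ha2⟩ := hN p₂ hrp₂ (by linarith [hp₂.2])
  set y := |piQ M q c - piQ M q d| with hy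
  set a := |piQ M p₂ c - piQ M p₂ d| with ha
  have hy0 : 0 ≤ y := abs_nonneg _
  have ha0 : 0 ≤ a := abs_nonneg _
  obtain ⟨hpw1, hpw2⟩ := hpow p₂ (by rw [abs_lt]; constructor <;> linarith [hp₂.1, hp₂.2])
  have hya := le_rpow_of_pow_bounds hκpos (by linarith) hy0 ha0 ht0 hq1 ha2 hpw1
  have hay := le_rpow_of_pow_bounds hκpos (by linarith) ha0 hy0 ht0 ha1 hq2 hpw2
  have ha' : a = |piQ M p₁ c - piQ M p₂ c| := by rw [ha, hd1, hc1, abs_sub_comm]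
  have hup : a ≤ B * |p₁ - p₂| := ha' ▸ abs_piQ_sub_le hr1 hrp₁ hrp₂ c
  have hlow : |p₁ - p₂| ≤ ((M : ℝ) + 1) / x * a := by
    have h1 := piQ_scale h11 hle c
    have h2 : x - piQ M p₂ c ≤ a := by rw [ha', hc1]; exact le_abs_self _
    have h3 : p₂ ≤ M + 1 := by linarith [hp₂.2]
    rw [abs_sub_comm, abs_of_nonneg (by linarith), div_mul_eq_mul_div, le_div_iff₀ hx]
    rw [hc1] at h1
    nlinarith
  have hyt : 0 ≤ y ^ t := by positivity
  have hpt : 0 ≤ |p₁ - p₂| ^ t := by positivity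
  constructor
  · calc |p₁ - p₂| ≤ ((M : ℝ) + 1) / x * a := hlow
      _ ≤ ((M : ℝ) + 1) / x * (E / κ ^ t * y ^ t) := by gcongr
      _ = C₁ * y ^ t := by rw [hC₁]; ring
      _ ≤ max C₁ C₂ * y ^ t := by gcongr; exact le_max_left _ _
  · calc y ≤ E / κ ^ t * a ^ t := hay
      _ ≤ E / κ ^ t * (B * |p₁ - p₂|) ^ t := by gcongr
      _ = C₂ * |p₁ - p₂| ^ t := by
        rw [Real.mul_rpow hBpos (abs_nonneg _), hC₂]; ring
      _ ≤ max C₁ C₂ * |p₁ - p₂| ^ t := by gcongr; exact le_max_right _ _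

/-- The bases `p` within `δ` of `q` in which `x` has an expansion from `D`. -/
def nearBases (D : Set (Digits M)) (x q δ : ℝ) : Set ℝ :=
  {p | p ∈ Set.Ioo (q - δ) (q + δ) ∧ ∃ d ∈ D, piQ M p d = x}

/-- The numbers within `δ` of `x` that have a base `q` expansion from `D`. -/
def nearValues (D : Set (Digits M)) (x q δ : ℝ) : Set ℝ :=
  {y | y ∈ Set.Ioo (x - δ) (x + δ) ∧ ∃ d ∈ D, piQ M q d = y}

theorem nearBases_mono (D : Set (Digits M)) (x q : ℝ) : Monotone (nearBases D x q) :=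
  fun _ _ h _ hp => ⟨Set.Ioo_subset_Ioo (by linarith) (by linarith) hp.1, hp.2⟩

theorem nearValues_mono (D : Set (Digits M)) (x q : ℝ) : Monotone (nearValues D x q) :=
  fun _ _ h _ hp => ⟨Set.Ioo_subset_Ioo (by linarith) (by linarith) hp.1, hp.2⟩

theorem exists_dimH_nearBases_le {p₀ q x t : ℝ} (hp₀ : 1 < p₀) (hpq : p₀ < q) (hqM : q < M + 1)
    (hx : 0 < x) (ht0 : 0 < t) (ht1 : t < 1) {δ' : ℝ} (hδ' : 0 < δ') :
    ∃ δ > 0, dimH (nearBases (UqSym M p₀) x q δ) ≤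
      dimH (nearValues (UqSym M p₀) x q δ') / ENNReal.ofReal t := by
  obtain ⟨C, hC, δ₁, hδ₁, hlo, -, h⟩ := base_value_holder hp₀ hpq hqM hx ht0 ht1
  set B := (M : ℝ) / (p₀ - 1) ^ 2 with hB
  have hBpos : 0 ≤ B := by positivity
  refine ⟨min δ₁ (δ' / (B + 1)), lt_min hδ₁ (by positivity), ?_⟩
  set δ := min δ₁ (δ' / (B + 1)) with hδ
  have hd1 : δ ≤ δ₁ := min_le_left _ _
  have hd2 : δ ≤ δ' / (B + 1) := min_le_right _ _
  refine dimH_le_of_rel (R := fun p y => p ∈ Set.Ioo (q - δ₁) (q + δ₁) ∧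
    ∃ d ∈ UqSym M p₀, piQ M p d = x ∧ piQ M q d = y) hC ht0 ?_ ?_
  · rintro p ⟨hp, d, hd, hpd⟩
    refine ⟨piQ M q d, ⟨?_, d, hd, rfl⟩,
      Set.Ioo_subset_Ioo (by linarith) (by linarith) hp, d, hd, hpd, rfl⟩
    have h1 := abs_piQ_sub_le hp₀ hpq.le (show p₀ ≤ p by linarith [hp.1]) d
    have h2 : |q - p| < δ' / (B + 1) :=
      lt_of_lt_of_le (by rw [abs_lt]; constructor <;> linarith [hp.1, hp.2]) hd2
    rw [lt_div_iff₀ (by positivity)] at h2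
    have h3 : |piQ M q d - x| < δ' := by
      rw [← hpd]
      refine h1.trans_lt ?_
      rw [← hB]
      rcases eq_or_lt_of_le (abs_nonneg (q - p)) with h0 | h0
      · rw [← h0]; simpa using hδ'
      · nlinarith
    rw [abs_lt] at h3
    constructor <;> linarith [h3.1, h3.2]
  · rintro a a' _ _ ⟨ha, d, hd, h1, rfl⟩ ⟨ha', d', hd', h2, rfl⟩
    exact (h a ha a' ha' d hd d' hd' h1 h2).1

theorem exists_dimH_nearValues_le {p₀ q x t : ℝ} (hp₀ : 1 < p₀) (hpq : p₀ < q) (hqM : q < M + 1)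
    (hx : 0 < x) (ht0 : 0 < t) (ht1 : t < 1) {δ' : ℝ} (hδ' : 0 < δ') :
    ∃ δ > 0, dimH (nearValues (UqSym M p₀) x q δ) ≤
      dimH (nearBases (UqSym M p₀) x q δ') / ENNReal.ofReal t := by
  obtain ⟨C, hC, δ₁, hδ₁, hlo, -, h⟩ := base_value_holder hp₀ hpq hqM hx ht0 ht1
  set η := min δ₁ δ' / 2 with hη
  have hm : 0 < min δ₁ δ' := lt_min hδ₁ hδ'
  have hη0 : 0 < η := by positivity
  have hη1 : η < δ₁ := by linarith [min_le_left δ₁ δ']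
  have hη2 : η < δ' := by linarith [min_le_right δ₁ δ']
  have hq1 : 1 < q := hp₀.trans hpq
  refine ⟨x * η / (q + η), by positivity, ?_⟩
  set δ := x * η / (q + η) with hδ
  have hδq : δ * (q + η) = x * η := by rw [hδ]; field_simp
  have hδ0 : 0 < δ := by positivity
  refine dimH_le_of_rel (R := fun y p => p ∈ Set.Ioo (q - δ₁) (q + δ₁) ∧
    ∃ d ∈ UqSym M p₀, piQ M p d = x ∧ piQ M q d = y) hC ht0 ?_ ?_
  · rintro _ ⟨hy, d, hd, rfl⟩
    have hlow : 1 < q - η := by linarith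
    have h1 : x ≤ piQ M (q - η) d := by
      have := piQ_scale hlow (by linarith : q - η ≤ q) d
      have h2 : x * (q - η) ≤ q * piQ M q d := by
        nlinarith [hy.1]
      nlinarith
    have h2 : piQ M (q + η) d ≤ x := by
      have := piQ_scale hq1 (by linarith : q ≤ q + η) d
      have h2 : q * piQ M q d ≤ (q + η) * x := by
        nlinarith [hy.2]
      nlinarith
    obtain ⟨p, hp, hpx⟩ := exists_piQ_eq_of_le hlow (by linarith) d h1 h2
    exact ⟨p, ⟨⟨by linarith [hp.1], by linarith [hp.2]⟩, d, hd, hpx⟩,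
      ⟨by linarith [hp.1], by linarith [hp.2]⟩, d, hd, hpx, rfl⟩
  · rintro _ _ a a' ⟨ha, d, hd, h1, rfl⟩ ⟨ha', d', hd', h2, rfl⟩
    exact (h a ha a' ha' d hd d' hd' h1 h2).2

theorem sInf_le_sInf_of_forall_div {f g : ℝ → ℝ≥0∞}
    (h : ∀ t : ℝ, 0 < t → t < 1 → ∀ δ' > 0, ∃ δ > 0, f δ ≤ g δ' / ENNReal.ofReal t) :
    sInf (f '' Set.Ioi 0) ≤ sInf (g '' Set.Ioi 0) := by
  refine le_sInf ?_
  rintro _ ⟨δ', hδ', rfl⟩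
  refine ENNReal.le_of_forall_lt_one_mul_le fun a ha => ?_
  rcases eq_or_ne a 0 with rfl | ha0
  · simp
  have hat : a ≠ ⊤ := ne_top_of_lt ha
  obtain ⟨δ, hδ, hle⟩ := h a.toReal (ENNReal.toReal_pos ha0 hat)
    (by rwa [← ENNReal.toReal_one, ENNReal.toReal_lt_toReal hat ENNReal.one_ne_top]) δ' hδ'
  rw [ENNReal.ofReal_toReal hat] at hle
  have h1 : sInf (f '' Set.Ioi 0) ≤ g δ' / a := (sInf_le (Set.mem_image_of_mem f hδ)).trans hle
  rw [ENNReal.le_div_iff_mul_le (Or.inl ha0) (Or.inl hat)] at h1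
  rwa [mul_comm]

end Dimension

section Concatenation

variable {M : ℕ}

/-- The sequence `d` is eventually periodic. -/
def EventuallyPeriodic (d : Digits M) : Prop := ∃ N P, 0 < P ∧ ∀ n ≥ N, d (n + P) = d n

theorem countable_eventuallyPeriodic : {d : Digits M | EventuallyPeriodic d}.Countable := by
  have h : {d : Digits M | EventuallyPeriodic d} ⊆
      ⋃ N : ℕ, ⋃ P : ℕ, {d : Digits M | 0 < P ∧ ∀ n ≥ N, d (n + P) = d n} := by
    rintro d ⟨N, P, h⟩
    exact Set.mem_iUnion₂.mpr ⟨N, P, h⟩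
  refine Set.Countable.mono h (Set.countable_iUnion fun N => Set.countable_iUnion fun P => ?_)
  refine Set.MapsTo.countable_of_injOn
    (f := fun (d : Digits M) (i : Fin (N + P)) => d i) (Set.mapsTo_univ _ _) ?_
    (Set.to_countable _)
  rintro c ⟨hP, hc⟩ d ⟨-, hd⟩ hcd
  funext n
  induction n using Nat.strong_induction_on with
  | _ n ih =>
    rcases lt_or_ge n (N + P) with hn | hn
    · exact congrFun hcd ⟨n, hn⟩
    · have h1 := hc (n - P) (by omega)
      have h2 := hd (n - P) (by omega)
      rw [Nat.sub_add_cancel (by omega)] at h1 h2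
      rw [h1, h2, ih (n - P) (by omega)]

theorem EventuallyPeriodic.of_signed_shift {b : Bool} {n : ℕ} {d : Digits M}
    (h : EventuallyPeriodic (signed b (shift n d))) : EventuallyPeriodic d := by
  obtain ⟨N, P, hP, h⟩ := h
  refine ⟨N + n, P, hP, fun m hm => ?_⟩
  have h1 := h (m - n) (by omega)
  simp only [signed, shift] at h1
  rw [show m - n + P + n = m + P by omega, show m - n + n = m by omega] at h1
  cases b
  · simpa using h1
  · simpa using h1

/-- The first `L` digits of `u` are lexicographically smaller than those of `w`. -/
def PrefixLt (L : ℕ) (u w : Digits M) : Prop := ∃ k < L, (∀ i < k, u i = w i) ∧ u k < w k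

theorem exists_prefix_max (L : ℕ) {T : Set (Digits M)} (hT : T.Nonempty) :
    ∃ w ∈ T, ∀ u ∈ T, (∀ i < L, u i = w i) ∨ PrefixLt L u w := by
  induction L with
  | zero =>
    obtain ⟨w, hw⟩ := hT
    exact ⟨w, hw, fun u _ => Or.inl fun i hi => absurd hi (Nat.not_lt_zero i)⟩
  | succ L ih =>
    obtain ⟨w, hw, h⟩ := ih
    obtain ⟨_, ⟨v, ⟨hv, hvw⟩, rfl⟩, hm⟩ := Set.exists_max_image
      ((fun u : Digits M => u L) '' {u | u ∈ T ∧ ∀ i < L, u i = w i}) id (Set.toFinite _)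
      ⟨_, w, ⟨hw, fun _ _ => rfl⟩, rfl⟩
    refine ⟨v, hv, fun u hu => ?_⟩
    rcases h u hu with h1 | ⟨k, hk, h1, h2⟩
    · rcases (hm _ ⟨u, ⟨hu, h1⟩, rfl⟩).eq_or_lt with h3 | h3
      · left
        intro i hi
        rcases Nat.lt_succ_iff_lt_or_eq.mp hi with hi | rfl
        · rw [h1 i hi, hvw i hi]
        · exact h3
      · exact Or.inr ⟨L, Nat.lt_succ_self L, fun i hi => by rw [h1 i hi, hvw i hi], h3⟩
    · exact Or.inr ⟨k, by omega, fun i hi => by rw [h1 i hi, hvw i (by omega)],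
        by rwa [hvw k hk]⟩

/-- The tail of `t` at position `n`, reflected according to `b`, starts with the first `L` digits
of `w`. -/
def Matches (t w : Digits M) (L n : ℕ) (b : Bool) : Prop :=
  ∀ i < L, signed b (shift n t) i = w i

theorem signed_shift_add (t : Digits M) (b : Bool) (m i j : ℕ) :
    signed b (shift m t) (i + j) = signed b (shift (m + i) t) j := by
  simp only [signed, shift]
  rw [show i + j + m = j + (m + i) by omega]

theorem signed_xor_apply (a b : Bool) (d : Digits M) (i : ℕ) :
    signed (a ^^ b) d i = signed a (signed b d) i := by
  rw [signed_signed]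

theorem signed_congr (b : Bool) {c d : Digits M} {i j : ℕ} (h : c i = d j) :
    signed b c i = signed b d j := by
  simp only [signed, h]

variable (t w : Digits M) (L : ℕ) (sg : ℕ → Bool)

/-- Walk along `t` one position at a time, except that on reaching an occurrence of the word
formed by the first `L` digits of `w` (or of its reflection) one jumps to position `B`. -/
noncomputable def walkStep (B : ℕ) (s : ℕ × Bool) : ℕ × Bool :=
  if Matches t w L (s.1 + 1) (sg (s.1 + 1)) then (B, (s.2 ^^ sg (s.1 + 1)) ^^ sg B)
  else (s.1 + 1, s.2)

/-- The sequence of digits read off along the walk given by `walkStep`. -/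
noncomputable def walk (B : ℕ) (s : ℕ × Bool) : Digits M := fun i =>
  signed ((walkStep t w L sg B)^[i] s).2 (shift ((walkStep t w L sg B)^[i] s).1 t) 0

variable {t w L sg} {B : ℕ}

theorem shift_walk (s : ℕ × Bool) (n : ℕ) :
    shift n (walk t w L sg B s) = walk t w L sg B ((walkStep t w L sg B)^[n] s) := by
  funext i
  simp only [shift, walk, Function.iterate_add_apply]

theorem walkStep_xor (b : Bool) (s : ℕ × Bool) :
    walkStep t w L sg B (s.1, b ^^ s.2) =
      ((walkStep t w L sg B s).1, b ^^ (walkStep t w L sg B s).2) := by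
  unfold walkStep
  split_ifs <;> simp

theorem walkStep_iterate_xor (b : Bool) (n : ℕ) (s : ℕ × Bool) :
    (walkStep t w L sg B)^[n] (s.1, b ^^ s.2) =
      (((walkStep t w L sg B)^[n] s).1, b ^^ ((walkStep t w L sg B)^[n] s).2) := by
  induction n with
  | zero => rfl
  | succ n ih => rw [Function.iterate_succ_apply', Function.iterate_succ_apply', ih, walkStep_xor]

theorem signed_walk (b : Bool) (s : ℕ × Bool) :
    signed b (walk t w L sg B s) = walk t w L sg B (s.1, b ^^ s.2) := by
  funext i
  have : walk t w L sg B (s.1, b ^^ s.2) i = signed b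
      (signed ((walkStep t w L sg B)^[i] s).2 (shift ((walkStep t w L sg B)^[i] s).1 t)) 0 := by
    rw [signed_signed]
    simp only [walk, walkStep_iterate_xor]
  rw [this]
  rfl

theorem walk_apply_of_le (hB : Matches t w L B (sg B)) (s : ℕ × Bool) {j : ℕ} (hj : j ≤ L) :
    walk t w L sg B s j = signed s.2 (shift s.1 t) j := by
  induction j generalizing s with
  | zero => rfl
  | succ j ih =>
    have h1 : walk t w L sg B s (j + 1) = walk t w L sg B (walkStep t w L sg B s) j := rfl
    rw [h1, ih _ (by omega), add_comm j 1, signed_shift_add]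
    unfold walkStep
    split_ifs with h
    · have h2 := hB j (by omega)
      have h3 := h j (by omega)
      rw [signed_xor_apply]
      refine (signed_congr _ (h2.trans h3.symm)).trans ?_
      rw [signed_signed]
      simp
    · rfl

theorem walkStep_iterate_of_not_matches {m k : ℕ} (b : Bool)
    (h : ∀ i, m < i → i ≤ m + k → ¬ Matches t w L i (sg i)) :
    (walkStep t w L sg B)^[k] (m, b) = (m + k, b) := by
  induction k with
  | zero => rfl
  | succ k ih =>
    rw [Function.iterate_succ_apply', ih fun i h1 h2 => h i h1 (by omega)]
    unfold walkStep
    rw [if_neg (h _ (by simp only; omega) (by simp only; omega))]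
    rfl

theorem walk_apply_of_not_matches (hB : Matches t w L B (sg B)) {m k : ℕ} (b : Bool)
    (h : ∀ i, m < i → i ≤ m + k → ¬ Matches t w L i (sg i)) {j : ℕ} (hj : j ≤ k + L) :
    walk t w L sg B (m, b) j = signed b (shift m t) j := by
  have hw := shift_walk (t := t) (w := w) (L := L) (sg := sg) (B := B) (m, b) (min j k)
  rw [walkStep_iterate_of_not_matches b fun i h1 h2 => h i h1 (by omega)] at hw
  have h1 := walk_apply_of_le hB (m + min j k, b) (show j - min j k ≤ L by omega)
  rw [← hw] at h1
  simp only [shift] at h1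
  rw [Nat.sub_add_cancel (min_le_left _ _)] at h1
  rw [h1]
  simp only [signed, shift]
  rw [show j - min j k + (m + min j k) = j + m by omega]

theorem lexLt_walk (hsg : ∀ n b, Matches t w L n b → sg n = b)
    (hmax : ∀ n b, (∀ i < L, signed b (shift (n + 1) t) i = w i) ∨
      PrefixLt L (signed b (shift (n + 1) t)) w)
    {A : ℕ} (hA : Matches t w L A (sg A)) (hB : Matches t w L B (sg B))
    (hlt : lexLt (walk t w L sg B (B, sg B)) (walk t w L sg B (A, sg A))) (b : Bool) (n : ℕ) :
    lexLt (signed b (shift (n + 1) (walk t w L sg B (A, sg A)))) (walk t w L sg B (A, sg A)) := by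
  set e := walk t w L sg B (A, sg A) with he
  have hew : ∀ i < L, e i = w i := fun i hi => (walk_apply_of_le hB _ hi.le).trans (hA i hi)
  obtain ⟨s, hs⟩ : ∃ s, signed b (shift (n + 1) e) = walk t w L sg B (walkStep t w L sg B s) := by
    refine ⟨(((walkStep t w L sg B)^[n] (A, sg A)).1,
      b ^^ ((walkStep t w L sg B)^[n] (A, sg A)).2), ?_⟩
    rw [he, shift_walk, signed_walk, walkStep_xor, Function.iterate_succ_apply']
  rw [hs]
  have hag : ∀ j < L, walk t w L sg B (walkStep t w L sg B s) j =
      signed s.2 (shift (s.1 + 1) t) j := by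
    intro j hj
    have h1 : walk t w L sg B s (j + 1) = walk t w L sg B (walkStep t w L sg B s) j := rfl
    rw [← h1, walk_apply_of_le hB s (show j + 1 ≤ L from hj), add_comm j 1, signed_shift_add]
  rcases hmax s.1 s.2 with h | ⟨k, hk, h1, h2⟩
  · have hb := hsg _ _ h
    have : walkStep t w L sg B s = (B, sg B) := by
      unfold walkStep
      rw [if_pos (by rw [hb]; exact h), hb]
      simp
    rw [this]
    exact hlt
  · refine ⟨k, fun i hi => ?_, ?_⟩
    · rw [hag i (by omega), hew i (by omega), h1 i hi]
    · rw [hag k hk, hew k hk]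
      exact h2

/-- A sequence whose shifts and reflected shifts are bounded by a word `w` that occurs in it is
eventually periodic, or else some sequence starting with `w` is strictly larger than all its shifts
and their reflections. -/
theorem eventuallyPeriodic_or_exists_lexLt (hL : 0 < L)
    (hmax : ∀ n b, (∀ i < L, signed b (shift (n + 1) t) i = w i) ∨
      PrefixLt L (signed b (shift (n + 1) t)) w)
    {m₀ : ℕ} {b₀ : Bool} (hm₀ : Matches t w L m₀ b₀) :
    EventuallyPeriodic t ∨ ∃ e : Digits M, (∀ i < L, e i = w i) ∧
      ∀ b n, lexLt (signed b (shift (n + 1) e)) e := by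
  by_cases hself : Fin.rev (w 0) = w 0
  · left
    have hle : ∀ n b, signed b (shift (n + 1) t) 0 ≤ w 0 := by
      intro n b
      rcases hmax n b with h | ⟨k, -, h1, h2⟩
      · exact (h 0 hL).le
      · rcases Nat.eq_zero_or_pos k with rfl | hk
        · exact h2.le
        · exact (h1 0 hk).le
    have hconst : ∀ n, t (n + 1) = w 0 := by
      intro n
      have h1 := hle n false
      have h2 := hle n true
      simp only [signed, shift, zero_add, if_true, Bool.false_eq_true, if_false] at h1 h2
      rw [← hself, Fin.rev_le_rev] at h2
      exact le_antisymm h1 h2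
    refine ⟨1, 1, one_pos, fun n hn => ?_⟩
    obtain ⟨n, rfl⟩ := Nat.exists_eq_add_of_le' hn
    rw [hconst, hconst]
  obtain ⟨sg, hsg⟩ : ∃ sg : ℕ → Bool, ∀ n b, Matches t w L n b → sg n = b := by
    refine ⟨fun n => decide (Matches t w L n true), fun n b hb => ?_⟩
    cases b
    · refine decide_eq_false fun ht => hself ?_
      have h1 := hb 0 hL
      have h2 := ht 0 hL
      simp only [signed, if_true, Bool.false_eq_true, if_false] at h1 h2
      rw [h1] at h2
      exact h2
    · exact decide_eq_true hb
  have hm₀' : Matches t w L m₀ (sg m₀) := by rwa [hsg _ _ hm₀]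
  by_cases hinf : ∃ A, Matches t w L A (sg A) ∧ ∀ n > A, ¬ Matches t w L n (sg n)
  · right
    obtain ⟨A, hA, hlast⟩ := hinf
    refine ⟨signed (sg A) (shift A t), hA, fun b n => ?_⟩
    rw [shift_signed, shift_shift, signed_signed, show n + 1 + A = (n + A) + 1 by omega]
    rcases hmax (n + A) (b ^^ sg A) with h | ⟨k, hk, h1, h2⟩
    · refine absurd ?_ (hlast (n + A + 1) (by omega))
      rw [hsg _ _ h]
      exact h
    · exact ⟨k, fun i hi => (h1 i hi).trans (hA i (by omega)).symm, by rwa [hA k hk]⟩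
  push Not at hinf
  have hgap : ∀ A, Matches t w L A (sg A) → ∃ k, Matches t w L (A + k + 1) (sg (A + k + 1)) ∧
      ∀ i, A < i → i ≤ A + k → ¬ Matches t w L i (sg i) := by
    intro A hA
    have hex : ∃ k, Matches t w L (A + k + 1) (sg (A + k + 1)) := by
      obtain ⟨n, hn, h⟩ := hinf A hA
      refine ⟨n - A - 1, ?_⟩
      rwa [show A + (n - A - 1) + 1 = n by omega]
    refine ⟨Nat.find hex, Nat.find_spec hex, fun i h1 h2 => ?_⟩
    have := Nat.find_min hex (m := i - A - 1) (by omega)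
    rwa [show A + (i - A - 1) + 1 = i by omega] at this
  choose! gap hgap1 hgap2 using hgap
  have hwalk : ∀ A B, Matches t w L A (sg A) → Matches t w L B (sg B) → ∀ j ≤ gap A + L,
      walk t w L sg B (A, sg A) j = signed (sg A) (shift A t) j := fun A B hA hB j hj =>
    walk_apply_of_not_matches hB _ (hgap2 A hA) hj
  by_cases hdiff : ∃ A B, Matches t w L A (sg A) ∧ Matches t w L B (sg B) ∧
      ∃ j, j ≤ gap A + L ∧ j ≤ gap B + L ∧
        signed (sg B) (shift B t) j ≠ signed (sg A) (shift A t) j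
  · right
    obtain ⟨A, B, hA, hB, hj⟩ := hdiff
    have hmin := fun i => Nat.find_min hj (m := i)
    obtain ⟨hjA, hjB, hne⟩ := Nat.find_spec hj
    set j := Nat.find hj with hjdef
    have hbelow : ∀ i < j, signed (sg B) (shift B t) i = signed (sg A) (shift A t) i := by
      intro i hi
      by_contra hcon
      exact hmin i hi ⟨by omega, by omega, hcon⟩
    have hwin : ∀ A B, Matches t w L A (sg A) → Matches t w L B (sg B) →
        j ≤ gap A + L → j ≤ gap B + L →
        (∀ i < j, signed (sg B) (shift B t) i = signed (sg A) (shift A t) i) →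
        signed (sg B) (shift B t) j < signed (sg A) (shift A t) j →
        ∃ e : Digits M, (∀ i < L, e i = w i) ∧ ∀ b n, lexLt (signed b (shift (n + 1) e)) e := by
      intro A B hA hB hjA hjB hbelow hlt
      refine ⟨walk t w L sg B (A, sg A), fun i hi =>
        (walk_apply_of_le hB _ hi.le).trans (hA i hi), lexLt_walk hsg hmax hA hB ⟨j, ?_, ?_⟩⟩
      · intro i hi
        rw [hwalk A B hA hB i (by omega), hwalk B B hB hB i (by omega), hbelow i hi]
      · rwa [hwalk A B hA hB j hjA, hwalk B B hB hB j hjB]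
    rcases lt_or_gt_of_ne hne with hlt | hlt
    · exact hwin A B hA hB hjA hjB hbelow hlt
    · exact hwin B A hB hA hjB hjA (fun i hi => (hbelow i hi).symm) hlt
  left
  push Not at hdiff
  have hnext : ∀ A B, Matches t w L A (sg A) → Matches t w L B (sg B) → gap A ≤ gap B →
      Matches t w L (B + gap A + 1) ((sg B ^^ sg A) ^^ sg (A + gap A + 1)) := by
    intro A B hA hB hle i hi
    have h1 := hdiff A B hA hB (gap A + 1 + i) (by omega) (by omega)
    rw [signed_shift_add, signed_shift_add] at h1
    have h2 := hgap1 A hA i hi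
    rw [← h2, show ((sg B ^^ sg A) ^^ sg (A + gap A + 1)) =
      ((sg A ^^ sg (A + gap A + 1)) ^^ sg B) by
        cases sg A <;> cases sg B <;> cases sg (A + gap A + 1) <;> rfl]
    rw [signed_xor_apply]
    refine (signed_congr _ h1).trans ?_
    rw [signed_signed, show ((sg A ^^ sg (A + gap A + 1)) ^^ sg A) = sg (A + gap A + 1) by
      cases sg A <;> cases sg (A + gap A + 1) <;> rfl]
    rfl
  have hgap_eq : ∀ A B, Matches t w L A (sg A) → Matches t w L B (sg B) → gap B ≤ gap A := by
    intro A B hA hB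
    by_contra! hlt
    have h := hnext A B hA hB hlt.le
    have h1 := hsg _ _ h
    refine hgap2 B hB (B + gap A + 1) (by omega) (by omega) ?_
    rw [h1]
    exact h
  set k := gap m₀ with hk
  have hgk : ∀ A, Matches t w L A (sg A) → gap A = k := fun A hA =>
    le_antisymm (hgap_eq m₀ A hm₀' hA) (hgap_eq A m₀ hA hm₀')
  have hper : ∀ A, Matches t w L A (sg A) → ∀ j ≤ k, t (A + j + 2 * (k + 1)) = t (A + j) := by
    intro A hA j hj
    have hA' := hgap1 A hA
    have h := hnext A _ hA hA' (hgap_eq _ A hA' hA)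
    rw [hgk A hA] at hA' h
    have hs : sg (A + k + 1 + k + 1) = sg A := by
      rw [hsg _ _ h]
      cases sg A <;> cases sg (A + k + 1) <;> rfl
    have hA'' : Matches t w L (A + k + 1 + k + 1) (sg (A + k + 1 + k + 1)) := by
      rw [hsg _ _ h]
      exact h
    have h2 := hdiff A _ hA hA'' j (by rw [hgk A hA]; omega) (by rw [hgk _ hA'']; omega)
    rw [hs] at h2
    simp only [signed, shift] at h2
    rw [show j + (A + k + 1 + k + 1) = A + j + 2 * (k + 1) by omega, add_comm j A] at h2
    cases hb : sg A
    · simpa [hb] using h2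
    · simpa [hb] using h2
  have hcover : ∀ n ≥ m₀, ∃ A, Matches t w L A (sg A) ∧ A ≤ n ∧ n ≤ A + k := by
    intro n hn
    induction n, hn using Nat.le_induction with
    | base => exact ⟨m₀, hm₀', le_rfl, by omega⟩
    | succ n _ ih =>
      obtain ⟨A, hA, h1, h2⟩ := ih
      rcases Nat.lt_or_ge n (A + k) with h | h
      · exact ⟨A, hA, by omega, by omega⟩
      · obtain rfl : n = A + k := le_antisymm h2 h
        have := hgap1 A hA
        rw [hgk A hA] at this
        exact ⟨_, this, le_rfl, by omega⟩
  refine ⟨m₀, 2 * (k + 1), by omega, fun n hn => ?_⟩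
  obtain ⟨A, hA, h1, h2⟩ := hcover n hn
  have := hper A hA (n - A) (by omega)
  rwa [show A + (n - A) = n by omega] at this

end Concatenation

section Variation

variable {M : ℕ}

theorem piQ_le_add_of_agree {q : ℝ} (hq : 1 < q) {L : ℕ} {c d : Digits M}
    (h : ∀ i < L, c i = d i) : piQ M q d ≤ piQ M q c + M / (q - 1) / q ^ L := by
  have h1 := piQ_sub_of_agree hq L h
  have h2 := piQ_le hq (shift L d)
  have h3 := piQ_nonneg hq (shift L c)
  have h4 : piQ M q d - piQ M q c ≤ M / (q - 1) / q ^ L := by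
    rw [le_div_iff₀ (by positivity)]
    linarith
  linarith

theorem one_le_piQ_shift {q : ℝ} (hq : 1 < q) {u : Digits M} (hu : 1 ≤ piQ M q u) {k : ℕ}
    (hk : ∀ i < k, u i = 0) : 1 ≤ piQ M q (shift k u) := by
  induction k with
  | zero => exact hu
  | succ k ih =>
    have h1 := ih fun i hi => hk i (by omega)
    have h2 := piQ_shift_one hq (shift k u)
    rw [shift_shift, add_comm 1 k] at h2
    have h3 : shift k u 0 = 0 := by simpa [shift] using hk k (by omega)
    rw [h3] at h2
    simp only [Fin.val_zero, Nat.cast_zero, zero_add] at h2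
    nlinarith

theorem exists_div_pow_lt {q A ε : ℝ} (hq : 1 < q) (hε : 0 < ε) :
    ∃ N : ℕ, ∀ L ≥ N, A / q ^ L < ε := by
  obtain ⟨N, hN⟩ := pow_unbounded_of_one_lt (A / ε) hq
  refine ⟨N, fun L hL => ?_⟩
  have h : q ^ N ≤ q ^ L := pow_le_pow_right₀ hq.le hL
  rw [div_lt_iff₀ hε] at hN
  rw [div_lt_iff₀ (by positivity)]
  nlinarith

theorem eventuallyPeriodic_of_signedTails {r p₁ p₂ r' : ℝ} (hr : 1 < r) (hr₁ : r < p₁)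
    (h₁₂ : p₁ < p₂) (hr₂ : p₂ < r') (hr' : r' ≤ M + 1)
    (hgap : ∀ p ∈ Set.Ioo r r', p ∉ Ubases M 1) {t : Digits M} (ht₁ : 1 ≤ piQ M p₁ t)
    (ht₂ : ∀ v ∈ signedTails t, piQ M p₂ v < 1) : EventuallyPeriodic t := by
  have hr'1 : 1 < r' := by linarith
  have hε₁ : 0 < p₁ / r - 1 := by rw [sub_pos, one_lt_div (by linarith)]; exact hr₁
  have hε₂ : 0 < 1 - p₂ / r' := by rw [sub_pos, div_lt_one (by linarith)]; exact hr₂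
  obtain ⟨N₁, hN₁⟩ := exists_div_pow_lt (A := M / (r - 1)) hr hε₁
  obtain ⟨N₂, hN₂⟩ := exists_div_pow_lt (A := M / (r' - 1)) hr'1 hε₂
  set L := max N₁ N₂ + 1 with hL
  have hL₁ := hN₁ L (by omega)
  have hL₂ := hN₂ L (by omega)
  obtain ⟨w, hw, hmax⟩ := exists_prefix_max L (T := signedTails t) ⟨t, Or.inl rfl⟩
  obtain ⟨m₀, b₀, hm₀⟩ : ∃ m b, Matches t w L m b := by
    rcases hw with rfl | ⟨b, n, rfl⟩
    · exact ⟨0, false, fun i _ => by rw [signed_false, shift_zero]⟩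
    · exact ⟨n + 1, b, fun i _ => rfl⟩
  rcases eventuallyPeriodic_or_exists_lexLt (t := t) (w := w) (L := L) (by omega)
    (fun n b => hmax _ (Or.inr ⟨b, n, rfl⟩)) hm₀ with h | ⟨e, hew, he⟩
  · exact h
  exfalso
  have he' : piQ M r' e < 1 := by
    have h1 := piQ_le_add_of_agree hr'1 (fun i hi => (hew i hi).symm)
    have h2 : piQ M r' w ≤ p₂ / r' := by
      rw [le_div_iff₀ (by linarith)]
      have := piQ_scale (by linarith) hr₂.le w
      nlinarith [ht₂ w hw]
    linarith
  have hγ : 0 ≤ M / (r - 1) / r ^ L := by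
    have : 0 < r - 1 := by linarith
    positivity
  have he1 : 1 < piQ M r e := by
    by_contra! hle
    have h1 := piQ_le_of_lexLt hr hγ hle shift_mem_signedTails (fun v hv => by
      rcases hmax v hv with h | ⟨k, hk, h1, h2⟩
      · left
        have := piQ_le_add_of_agree hr (c := e) (d := v) (L := L)
          fun i hi => (hew i hi).trans (h i hi).symm
        linarith
      · exact Or.inr ⟨k, fun i hi => (h1 i hi).trans (hew i (by omega)).symm,
          by rwa [hew k hk]⟩) t (Or.inl rfl)
    have h2 := piQ_scale hr hr₁.le t
    have h3 : p₁ / r ≤ piQ M r t := by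
      rw [div_le_iff₀ (by linarith)]
      nlinarith
    linarith
  obtain ⟨p, hp, hpe⟩ := exists_piQ_eq_of_le hr (by linarith) e he1.le he'.le
  have h1 : r < p := lt_of_le_of_ne hp.1 fun h => by rw [← h] at hpe; linarith
  have h2 : p < r' := lt_of_le_of_ne hp.2 fun h => by rw [h] at hpe; linarith
  exact hgap p ⟨h1, h2⟩ (mem_Ubases_one (by linarith) (by linarith) hpe he)

/-- On an interval without univoque bases of `1`, the symbolic univoque sets `𝐔_p` differ only by
eventually periodic sequences. -/
theorem UqSym_sdiff_subset {r p₁ p₂ r' : ℝ} (hr : 1 < r) (hr₁ : r < p₁)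
    (h₁₂ : p₁ < p₂) (hr₂ : p₂ < r') (hr' : r' ≤ M + 1)
    (hgap : ∀ p ∈ Set.Ioo r r', p ∉ Ubases M 1) :
    UqSym M p₂ \ UqSym M p₁ ⊆ {d | EventuallyPeriodic d} := by
  rintro d ⟨hd₂, hd₁⟩
  have hp₁ : 1 < p₁ := by linarith
  have hp₂ : 1 < p₂ := by linarith
  have hp₂M : p₂ ≤ M + 1 := by linarith
  rw [mem_UqSym_iff hp₁ (by linarith)] at hd₁
  push Not at hd₁
  obtain ⟨b, n, hn, hge⟩ := hd₁
  have hc := signed_mem_UqSym hp₂ b hd₂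
  have hc' := signed_mem_UqSym hp₂ true hc
  have hlow := piQ_shift_lt_one hp₂ hp₂M hc hn
  set c := signed b d with hcdef
  have hex : ∃ k, shift (n + 1) c k ≠ 0 := by
    by_contra! h0
    have : piQ M p₁ (shift (n + 1) c) = 0 := by
      unfold piQ
      simp [h0]
    linarith
  set k := Nat.find hex with hk
  have hk0 : c (k + (n + 1)) ≠ 0 := Nat.find_spec hex
  have ht₁ : 1 ≤ piQ M p₁ (shift k (shift (n + 1) c)) :=
    one_le_piQ_shift hp₁ hge fun i hi => not_not.mp (Nat.find_min hex hi)
  rw [shift_shift] at ht₁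
  have hrefl := piQ_shift_lt_one hp₂ hp₂M hc' (n := k + (n + 1)) (by
    have h1 : (c (k + (n + 1)) : ℕ) ≠ 0 := fun h => hk0 (Fin.ext h)
    have h2 := (c (k + (n + 1))).isLt
    simp only [signed, if_true, Fin.val_rev]
    omega)
  have hlt : ∀ m ≥ n + 1, piQ M p₂ (shift m c) < 1 := fun m hm =>
    piQ_shift_lt_one_of_le hp₂ hp₂M hc hm hlow
  have hEP := eventuallyPeriodic_of_signedTails hr hr₁ h₁₂ hr₂ hr' hgap ht₁ (by
    rintro v (rfl | ⟨a, m, rfl⟩)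
    · exact hlt _ (by omega)
    · rw [shift_shift]
      cases a
      · rw [signed_false]
        exact hlt _ (by omega)
      · exact piQ_shift_lt_one_of_le hp₂ hp₂M hc' (by omega) hrefl)
  rw [hcdef, shift_signed] at hEP
  exact hEP.of_signed_shift

theorem add_one_mem_Ubases_one (hM : 0 < M) : (M : ℝ) + 1 ∈ Ubases M 1 := by
  have hM' : (0 : ℝ) < M := by exact_mod_cast hM
  have hq : (1 : ℝ) < M + 1 := by linarith
  have hone : (M : ℝ) / (M + 1 - 1) = 1 := by
    rw [add_sub_cancel_right, div_self hM'.ne']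
  have hlast : piQ M (M + 1) (fun _ => Fin.last M) = 1 := by
    simpa only [piQ, Fin.val_last, hone] using (hasSum_inv_pow (M := M) hq).tsum_eq
  refine ⟨⟨hq, le_rfl⟩, _, hlast, fun f hf => ?_⟩
  funext i
  by_contra hi
  have h1 := piQ_add_signed_true hq f
  have h2 : 0 < piQ M (M + 1) (signed true f) := piQ_pos hq (i := i) (by
    simp only [signed, if_true, ne_eq]
    intro h
    exact hi (by rw [← Fin.rev_rev (f i), h, Fin.rev_zero]))
  linarith

theorem tendsto_dimH_of_monotone {f : ℝ → Set ℝ} (hf : Monotone f) :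
    Filter.Tendsto (fun δ => dimH (f δ)) (nhdsWithin 0 (Set.Ioi 0))
      (nhds (sInf ((fun δ => dimH (f δ)) '' Set.Ioi 0))) :=
  Monotone.tendsto_nhdsGT (f := fun δ => dimH (f δ)) (fun _ _ h => dimH_mono (hf h)) 0

theorem dimH_Ubases_inter_Ioo {p₀ p₁ q x δ : ℝ} (hx : 0 < x) (hp₀ : 1 < p₀)
    (hδ₀ : p₀ ≤ q - δ) (hδ₁ : q + δ ≤ p₁) (hp₁ : p₁ ≤ M + 1)
    (hcount : (UqSym M p₁ \ UqSym M p₀).Countable) :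
    dimH (Ubases M x ∩ Set.Ioo (q - δ) (q + δ)) = dimH (nearBases (UqSym M p₀) x q δ) := by
  have hmem : ∀ p ∈ Set.Ioo (q - δ) (q + δ), ∀ d ∈ UqSym M p₀, piQ M p d = x →
      p ∈ Ubases M x := by
    intro p hp d hd hdx
    have hpM : p ≤ M + 1 := by linarith [hp.2]
    have h := UqSym_mono hp₀ (by linarith [hp.1]) hpM hd
    exact ⟨⟨by linarith [hp.1], hpM⟩, d, hdx, fun e he => h e (he.trans hdx.symm)⟩
  refine dimH_eq_of_countable_diff ?_ ?_
  · rintro p ⟨hp, d, hd, hdx⟩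
    exact ⟨hmem p hp d hd hdx, hp⟩
  have hex : ∀ p ∈ (Ubases M x ∩ Set.Ioo (q - δ) (q + δ)) \ nearBases (UqSym M p₀) x q δ,
      ∃ d ∈ UqSym M p₁ \ UqSym M p₀, piQ M p d = x := by
    rintro p ⟨⟨⟨hp, d, hdx, hd⟩, hpI⟩, hnot⟩
    refine ⟨d, ⟨?_, fun hd' => hnot ⟨hpI, d, hd', hdx⟩⟩, hdx⟩
    have hdp : d ∈ UqSym M p := fun e he => hd e (he.trans hdx)
    exact UqSym_mono hp.1 (by linarith [hpI.2]) hp₁ hdp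
  choose! φ hφ hφx using hex
  refine Set.MapsTo.countable_of_injOn (f := φ) hφ (fun p hp p' hp' h => ?_) hcount
  refine piQ_base_inj hx hp.1.1.1.1 hp'.1.1.1.1 (hφx p hp) ?_
  rw [h]
  exact hφx p' hp'

theorem dimH_Uq_inter_Ioo {p₀ q p₁ x δ : ℝ} (hp₀ : 1 < p₀) (hpq : p₀ ≤ q) (hq₁ : q ≤ p₁)
    (hp₁ : p₁ ≤ M + 1) (hcount : (UqSym M p₁ \ UqSym M p₀).Countable) :
    dimH (Uq M q ∩ Set.Ioo (x - δ) (x + δ)) = dimH (nearValues (UqSym M p₀) x q δ) := by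
  refine dimH_eq_of_countable_diff ?_ ((hcount.image (piQ M q)).mono ?_)
  · rintro _ ⟨hy, d, hd, rfl⟩
    have h := UqSym_mono hp₀ hpq (hq₁.trans hp₁) hd
    exact ⟨⟨d, rfl, h⟩, hy⟩
  · rintro y ⟨⟨⟨d, hdy, hd⟩, hyI⟩, hnot⟩
    have hdq : d ∈ UqSym M q := fun e he => hd e (he.trans hdy)
    exact ⟨d, ⟨UqSym_mono (hp₀.trans_le hpq) hq₁ hp₁ hdq,
      fun hd' => hnot ⟨hyI, d, hd', hdy⟩⟩, hdy⟩

end Variation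

/-- Theorem (variation principle): for every `x > 0` and every `q ∈ (1, q_x]` not in the
closure of `𝒰`, the one-sided limits `lim_{δ→0⁺} dim_H (𝒰(x) ∩ (q-δ, q+δ))` and
`lim_{δ→0⁺} dim_H (𝒰_q ∩ (x-δ, x+δ))` exist and are equal (Euclidean Hausdorff dimension). -/
theorem variation_principle (M : ℕ) (hM : 0 < M) (x : ℝ) (hx : 0 < x) (q : ℝ)
    (hq : q ∈ Set.Ioc (1 : ℝ) (qx M x)) (hq' : q ∉ closure (Ubases M 1)) :
    ∃ L : ℝ≥0∞,
      Filter.Tendsto (fun δ : ℝ => dimH (Ubases M x ∩ Set.Ioo (q - δ) (q + δ)))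
        (nhdsWithin (0 : ℝ) (Set.Ioi 0)) (nhds L) ∧
      Filter.Tendsto (fun δ : ℝ => dimH (Uq M q ∩ Set.Ioo (x - δ) (x + δ)))
        (nhdsWithin (0 : ℝ) (Set.Ioi 0)) (nhds L) := by
  have hqM : q < M + 1 := by
    refine lt_of_le_of_ne (hq.2.trans (min_le_left _ _)) ?_
    rintro rfl
    exact hq' (subset_closure (add_one_mem_Ubases_one hM))
  have hq1 : 1 < q := hq.1
  obtain ⟨ε, hε, hball⟩ := Metric.isOpen_iff.mp isClosed_closure.isOpen_compl q hq'
  obtain ⟨s, hs, hsε, hsq, hsM⟩ : ∃ s > 0, 3 * s ≤ ε ∧ 3 * s < q - 1 ∧ 3 * s ≤ M + 1 - q := by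
    have hm : 0 < min ε (min (q - 1) (M + 1 - q)) :=
      lt_min hε (lt_min (by linarith) (by linarith))
    have h1 := min_le_left ε (min (q - 1) (M + 1 - q))
    have h2 := (min_le_right ε (min (q - 1) (M + 1 - q))).trans (min_le_left _ _)
    have h3 := (min_le_right ε (min (q - 1) (M + 1 - q))).trans (min_le_right _ _)
    exact ⟨min ε (min (q - 1) (M + 1 - q)) / 4, by positivity, by linarith, by linarith,
      by linarith⟩
  have hp₀ : 1 < q - 2 * s := by linarith
  have hp₁ : q + 2 * s ≤ M + 1 := by linarith
  have hpq : q - 2 * s < q := by linarith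
  have hcount : (UqSym M (q + 2 * s) \ UqSym M (q - 2 * s)).Countable := by
    refine countable_eventuallyPeriodic.mono (UqSym_sdiff_subset (r := q - 3 * s)
      (r' := q + 3 * s) (by linarith) (by linarith) (by linarith) (by linarith) (by linarith) ?_)
    intro p hp hpU
    refine hball ?_ (subset_closure hpU)
    rw [Metric.mem_ball, Real.dist_eq, abs_lt]
    constructor <;> linarith [hp.1, hp.2]
  have hnear : ∀ᶠ δ in nhdsWithin (0 : ℝ) (Set.Ioi 0), δ ≤ s :=
    nhdsWithin_le_nhds (eventually_le_nhds hs)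
  refine ⟨_, (tendsto_dimH_of_monotone (nearBases_mono (UqSym M (q - 2 * s)) x q)).congr' ?_, ?_⟩
  · filter_upwards [hnear] with δ hδ
    exact (dimH_Ubases_inter_Ioo hx hp₀ (by linarith) (by linarith) hp₁ hcount).symm
  · have heq := le_antisymm
      (sInf_le_sInf_of_forall_div fun t h0 h1 δ' hδ' =>
        exists_dimH_nearBases_le hp₀ hpq hqM hx h0 h1 hδ')
      (sInf_le_sInf_of_forall_div fun t h0 h1 δ' hδ' =>
        exists_dimH_nearValues_le hp₀ hpq hqM hx h0 h1 hδ')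
    rw [heq]
    refine (tendsto_dimH_of_monotone
      (nearValues_mono (UqSym M (q - 2 * s)) x q)).congr' (Filter.Eventually.of_forall fun δ => ?_)
    exact (dimH_Uq_inter_Ioo hp₀ hpq.le (by linarith) hp₁ hcount).symm

end Expansions
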